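/- arXiv:2204.06805 — 2 statements merged into one kernel-verified Lean document; each statement's English description precedes it below -/
import Mathlib

section
/- Let F = (x² − 2y²) z³ + (x(x² − 2y²) + 2x³) z² + (x⁴ + y⁴) z + x⁵, a homogeneous polynomial of degree 5 with coefficients in F_3 (here 2 is a non-square in F_3). The number of points of the projective plane ℙ²(F_9) at which F vanishes is exactly 29. (The unique singular point (0:0:1) of V(F) is a node that is non-split over F_3 but split over F_9, so the normalization of V(F) is a genus-five trigonal curve over F_3 with exactly 30 F_9-rational points.) -/
instance : Fact (Nat.Prime 3) := ⟨by norm_num⟩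

/-- The quintic form. -/
def quinticForm {R : Type*} [CommRing R] (x y z : R) : R :=
  (x ^ 2 - 2 * y ^ 2) * z ^ 3 + (x * (x ^ 2 - 2 * y ^ 2) + 2 * x ^ 3) * z ^ 2
    + (x ^ 4 + y ^ 4) * z + x ^ 5

theorem quinticForm_smul {R : Type*} [CommRing R] (c x y z : R) :
    quinticForm (c * x) (c * y) (c * z) = c ^ 5 * quinticForm x y z := by
  unfold quinticForm; ring

theorem quinticForm_map {R S : Type*} [CommRing R] [CommRing S] (f : R ≃+* S) (x y z : R) :
    quinticForm (f x) (f y) (f z) = f (quinticForm x y z) := by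
  have h2 : f 2 = 2 := map_ofNat f 2
  simp [quinticForm, h2]

/-- A concrete model of the field with nine elements. -/
abbrev ModelNine : Type := QuadraticAlgebra (ZMod 3) (-1) 0

instance : Fact (∀ r : ZMod 3, r ^ 2 ≠ -1 + 0 * r) := ⟨by decide⟩

instance : Fintype ModelNine := Fintype.ofEquiv _ (QuadraticAlgebra.equivProd _ _).symm

theorem card_modelNine : Fintype.card ModelNine = 9 := by
  rw [Fintype.card_congr (QuadraticAlgebra.equivProd _ _)]
  simp [ZMod.card]

/-- Value of the form at `(a + bi, c + di, e + fi)`, simplified modulo `3`. -/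
def formPair (p q r : ZMod 3 × ZMod 3) : ZMod 3 × ZMod 3 :=
  let mul (u v : ZMod 3 × ZMod 3) : ZMod 3 × ZMod 3 :=
    (u.1 * v.1 - u.2 * v.2, u.1 * v.2 + u.2 * v.1)
  let plus (u v : ZMod 3 × ZMod 3) : ZMod 3 × ZMod 3 := (u.1 + v.1, u.2 + v.2)
  let pp := mul p p
  let qq := mul q q
  let rr := mul r r
  plus (plus (mul (mul (plus pp qq) rr) r) (mul (mul p qq) rr))
    (plus (mul (plus (mul pp pp) (mul qq qq)) r) (mul (mul pp pp) p))

theorem three_model : (3 : ModelNine) = 0 := by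
  have h : algebraMap (ZMod 3) ModelNine 3 = 0 := by
    rw [show (3 : ZMod 3) = 0 by decide, map_zero]
  rwa [map_ofNat] at h

theorem quinticForm_reduce (x y z : ModelNine) : quinticForm x y z =
    (((x * x + y * y) * (z * z)) * z + (x * (y * y)) * (z * z))
      + (((x * x) * (x * x) + (y * y) * (y * y)) * z + ((x * x) * (x * x)) * x) := by
  unfold quinticForm
  linear_combination (-(y ^ 2 * z ^ 3) + (x ^ 3 - x * y ^ 2) * z ^ 2) * three_model

theorem quinticForm_eq_zero_iff (x y z : ModelNine) : quinticForm x y z = 0 ↔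
    formPair (x.re, x.im) (y.re, y.im) (z.re, z.im) = 0 := by
  rw [quinticForm_reduce, QuadraticAlgebra.ext_iff, Prod.ext_iff]
  simp [formPair, sub_eq_add_neg]
  apply Iff.of_eq
  congr 2 <;> ring

theorem count_pairs : (Finset.univ.filter
    fun t : (ZMod 3 × ZMod 3) × (ZMod 3 × ZMod 3) × (ZMod 3 × ZMod 3) =>
      t ≠ 0 ∧ formPair t.1 t.2.1 t.2.2 = 0).card = 232 := by
  decide +kernel

/-- Passing from the projective count to the count of nonzero vectors. -/
theorem card_projective_mul (K : Type*) [Field K] :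
    Nat.card {P : Projectivization K (Fin 3 → K) //
      quinticForm (P.rep 0) (P.rep 1) (P.rep 2) = 0} * Nat.card Kˣ =
    Nat.card {v : Fin 3 → K // v ≠ 0 ∧ quinticForm (v 0) (v 1) (v 2) = 0} := by
  rw [← Nat.card_prod]
  refine Nat.card_eq_of_bijective
    (fun p => ⟨(p.2 : K) • p.1.1.rep, smul_ne_zero p.2.ne_zero p.1.1.rep_nonzero, ?_⟩) ⟨?_, ?_⟩
  · simp only [Pi.smul_apply, smul_eq_mul, quinticForm_smul, p.1.2, mul_zero]
  · rintro ⟨⟨P, hP⟩, u⟩ ⟨⟨Q, hQ⟩, w⟩ h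
    simp only [Subtype.mk.injEq] at h
    have hPQ : P = Q := by
      rw [← P.mk_rep, ← Q.mk_rep, Projectivization.mk_eq_mk_iff']
      refine ⟨(u : K)⁻¹ * w, ?_⟩
      rw [mul_smul, ← h, inv_smul_smul₀ u.ne_zero]
    subst hPQ
    have : (u : K) = w := smul_left_injective K P.rep_nonzero h
    simp [Units.ext_iff, this]
  · rintro ⟨v, hv, hF⟩
    obtain ⟨a, ha⟩ := Projectivization.exists_smul_eq_mk_rep K v hv
    have ha' : (a : K) • v = (Projectivization.mk K v hv).rep := ha
    refine ⟨⟨⟨Projectivization.mk K v hv, ?_⟩, a⁻¹⟩, ?_⟩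
    · rw [← ha']
      simp only [Pi.smul_apply, smul_eq_mul, quinticForm_smul, hF, mul_zero]
    · simp only [Subtype.mk.injEq, ← ha', Units.val_inv_eq_inv_val]
      rw [inv_smul_smul₀ a.ne_zero]

theorem card_vectors (K : Type*) [Field K] (e : K ≃+* ModelNine) :
    Nat.card {v : Fin 3 → K // v ≠ 0 ∧ quinticForm (v 0) (v 1) (v 2) = 0} = 232 := by
  rw [← count_pairs, ← Fintype.card_subtype, ← Nat.card_eq_fintype_card]
  let g : K ≃ ZMod 3 × ZMod 3 := e.toEquiv.trans (QuadraticAlgebra.equivProd _ _)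
  have hg : ∀ x, g x = ((e x).re, (e x).im) := fun x => rfl
  have hg0 : ∀ x, g x = 0 ↔ x = 0 := by
    intro x
    rw [hg, ← e.map_eq_zero_iff, QuadraticAlgebra.ext_iff, Prod.ext_iff]
    rfl
  let E : (Fin 3 → K) ≃ (ZMod 3 × ZMod 3) × (ZMod 3 × ZMod 3) × (ZMod 3 × ZMod 3) :=
    { toFun := fun v => (g (v 0), g (v 1), g (v 2))
      invFun := fun t => ![g.symm t.1, g.symm t.2.1, g.symm t.2.2]
      left_inv := by
        intro v
        ext i
        fin_cases i <;> simp
      right_inv := by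
        intro t
        simp }
  refine Nat.card_congr (E.subtypeEquiv fun v => and_congr (not_congr ?_) ?_)
  · change v = 0 ↔ (g (v 0), g (v 1), g (v 2)) = 0
    simp only [Prod.mk_eq_zero, hg0, funext_iff, Fin.forall_fin_succ, Pi.zero_apply]
    simp
  · rw [← e.map_eq_zero_iff, ← quinticForm_map, quinticForm_eq_zero_iff]
    rfl

/-- The plane quintic `F₁₇ = (x² − 2y²)z³ + (x(x² − 2y²) + 2x³)z² + (x⁴ + y⁴)z + x⁵`
(non-split node case, ε = 2) has exactly `29` zeros in `ℙ²(F₉)`, so its normalization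
is a genus-five trigonal curve over `F₃` with `30` `F₉`-rational points. -/
theorem trigonal_example2_nonsplit_node_F9_count :
    Nat.card {P : Projectivization (GaloisField 3 2) (Fin 3 → GaloisField 3 2) //
      (P.rep 0 ^ 2 - 2 * P.rep 1 ^ 2) * P.rep 2 ^ 3
      + (P.rep 0 * (P.rep 0 ^ 2 - 2 * P.rep 1 ^ 2) + 2 * P.rep 0 ^ 3) * P.rep 2 ^ 2
      + (P.rep 0 ^ 4 + P.rep 1 ^ 4) * P.rep 2
      + P.rep 0 ^ 5 = 0} = 29 := by
  have hcard : Nat.card (GaloisField 3 2) = 9 := by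
    rw [GaloisField.card 3 2 (by norm_num)]; norm_num
  let _ : Fintype (GaloisField 3 2) := Fintype.ofFinite _
  have hc : Fintype.card (GaloisField 3 2) = Fintype.card ModelNine := by
    rw [card_modelNine, ← Nat.card_eq_fintype_card, hcard]
  have h := card_projective_mul (GaloisField 3 2)
  rw [card_vectors _ (FiniteField.ringEquivOfCardEq hc), Nat.card_units, hcard] at h
  change Nat.card {P : Projectivization (GaloisField 3 2) (Fin 3 → GaloisField 3 2) //
    quinticForm (P.rep 0) (P.rep 1) (P.rep 2) = 0} = 29
  omega
end

section
/- Let F = x² z³ + (x² y + y³) z² + (x⁴ + 2 x² y²) z + x⁴ y + y⁵, a homogeneous polynomial of degree 5 with coefficients in F_3. The number of points of the projective plane ℙ²(F_9) at which F vanishes is exactly 30. (The unique singular point (0:0:1) of V(F) is a cusp, so the normalization of V(F) is a genus-five trigonal curve over F_3 with exactly 30 F_9-rational points, the maximal possible number for a genus-five trigonal curve over F_3.) -/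
open Projectivization

/-- The quintic as a function on `R³`. -/
def quintic {R : Type*} [CommRing R] (x y z : R) : R :=
  x ^ 2 * z ^ 3 + (x ^ 2 * y + y ^ 3) * z ^ 2 + (x ^ 4 + 2 * x ^ 2 * y ^ 2) * z
    + x ^ 4 * y + y ^ 5

theorem quintic_smul {R : Type*} [CommRing R] (a x y z : R) :
    quintic (a * x) (a * y) (a * z) = a ^ 5 * quintic x y z := by
  unfold quintic; ring

theorem quintic_map {R S : Type*} [CommRing R] [CommRing S] (φ : R →+* S) (x y z : R) :
    quintic (φ x) (φ y) (φ z) = φ (quintic x y z) := by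
  have h2 : φ 2 = 2 := map_ofNat φ 2
  simp [quintic, h2]

/-- Normalized representatives of points in the plane. -/
def normVec {R : Type*} [CommRing R] : (R × R) ⊕ (R ⊕ Unit) → Fin 3 → R
  | .inl (y, z) => ![1, y, z]
  | .inr (.inl z) => ![0, 1, z]
  | .inr (.inr ()) => ![0, 0, 1]

theorem normVec_ne {K : Type*} [Field K] (t : (K × K) ⊕ (K ⊕ Unit)) : normVec t ≠ 0 := by
  intro h
  have h0 := congrFun h 0
  have h1 := congrFun h 1
  have h2 := congrFun h 2
  rcases t with ⟨y, z⟩ | z | ⟨⟩ <;> simp [normVec] at h0 h1 h2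

theorem normVec_bij {K : Type*} [Field K] :
    Function.Bijective
      (fun t : (K × K) ⊕ (K ⊕ Unit) => Projectivization.mk K (normVec t) (normVec_ne t)) := by
  constructor
  · intro s t h
    obtain ⟨a, h⟩ := (mk_eq_mk_iff' K _ _ _ _).1 h
    have h0 := congrFun h 0
    have h1 := congrFun h 1
    have h2 := congrFun h 2
    rcases s with ⟨y, z⟩ | z | ⟨⟩ <;> rcases t with ⟨y', z'⟩ | z' | ⟨⟩ <;>
      simp [normVec] at h0 h1 h2 <;> simp_all
  · intro P
    have hP := P.rep_nonzero
    by_cases h0 : P.rep 0 = 0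
    · by_cases h1 : P.rep 1 = 0
      · have h2 : P.rep 2 ≠ 0 := by
          intro h2
          apply hP
          funext i
          fin_cases i <;> simp [h0, h1, h2]
        refine ⟨.inr (.inr ()), ?_⟩
        conv_rhs => rw [← P.mk_rep]
        refine (mk_eq_mk_iff' K _ _ _ _).2 ⟨(P.rep 2)⁻¹, ?_⟩
        funext i
        fin_cases i <;> simp [normVec, h0, h1, h2]
      · refine ⟨.inr (.inl (P.rep 2 / P.rep 1)), ?_⟩
        conv_rhs => rw [← P.mk_rep]
        refine (mk_eq_mk_iff' K _ _ _ _).2 ⟨(P.rep 1)⁻¹, ?_⟩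
        funext i
        fin_cases i <;> simp [normVec, h0, h1, div_eq_inv_mul]
    · refine ⟨.inl (P.rep 1 / P.rep 0, P.rep 2 / P.rep 0), ?_⟩
      conv_rhs => rw [← P.mk_rep]
      refine (mk_eq_mk_iff' K _ _ _ _).2 ⟨(P.rep 0)⁻¹, ?_⟩
      funext i
      fin_cases i <;> simp [normVec, h0, div_eq_inv_mul]

theorem quintic_rep {K : Type*} [Field K] (v : Fin 3 → K) (hv : v ≠ 0) :
    quintic (v 0) (v 1) (v 2) = 0 ↔
      quintic ((Projectivization.mk K v hv).rep 0) ((Projectivization.mk K v hv).rep 1)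
        ((Projectivization.mk K v hv).rep 2) = 0 := by
  obtain ⟨a, ha⟩ := exists_smul_eq_mk_rep K v hv
  rw [← ha]
  simp only [Pi.smul_apply, Units.smul_def, smul_eq_mul, quintic_smul]
  simp

/-- A computable model of the field with nine elements. -/
abbrev NineModel := QuadraticAlgebra (ZMod 3) 2 0

instance : Fact (∀ r : ZMod 3, r ^ 2 ≠ 2 + 0 * r) := ⟨by decide⟩

instance : Fintype NineModel := Fintype.ofEquiv _ (QuadraticAlgebra.equivProd 2 0).symm

theorem exists_model : Nonempty (NineModel ≃+* GaloisField 3 2) := by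
  haveI := Fintype.ofFinite (GaloisField 3 2)
  refine ⟨FiniteField.ringEquivOfCardEq ?_⟩
  rw [← Nat.card_eq_fintype_card (α := GaloisField 3 2), GaloisField.card 3 2 (by norm_num),
    Fintype.card_congr (QuadraticAlgebra.equivProd (2 : ZMod 3) 0)]
  rfl

set_option maxRecDepth 100000 in
theorem model_count : Fintype.card {t : (NineModel × NineModel) ⊕ (NineModel ⊕ Unit) //
    quintic (normVec t 0) (normVec t 1) (normVec t 2) = 0} = 30 := by
  decide +kernel

theorem normVec_map {R S : Type*} [CommRing R] [CommRing S] (φ : R →+* S)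
    (t : (R × R) ⊕ (R ⊕ Unit)) (i : Fin 3) :
    normVec (Sum.map (Prod.map φ φ) (Sum.map φ id) t) i = φ (normVec t i) := by
  rcases t with ⟨y, z⟩ | z | ⟨⟩ <;> fin_cases i <;> simp [normVec]

/-- The plane quintic `F₁₈ = x²z³ + (x²y + y³)z² + (x⁴ + 2x²y²)z + x⁴y + y⁵`
(cusp case) has exactly `30` zeros in `ℙ²(F₉)`, so its normalization is a genus-five
trigonal curve over `F₃` with `30` `F₉`-rational points. -/
theorem trigonal_example_cusp_F9_count :
    Nat.card {P : Projectivization (GaloisField 3 2) (Fin 3 → GaloisField 3 2) //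
      P.rep 0 ^ 2 * P.rep 2 ^ 3
      + (P.rep 0 ^ 2 * P.rep 1 + P.rep 1 ^ 3) * P.rep 2 ^ 2
      + (P.rep 0 ^ 4 + 2 * P.rep 0 ^ 2 * P.rep 1 ^ 2) * P.rep 2
      + P.rep 0 ^ 4 * P.rep 1 + P.rep 1 ^ 5 = 0} = 30 := by
  obtain ⟨φ⟩ := exists_model
  rw [← model_count, ← Nat.card_eq_fintype_card]
  symm
  refine Nat.card_congr (Equiv.subtypeEquiv
    ((Equiv.sumCongr (Equiv.prodCongr φ.toEquiv φ.toEquiv)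
      (Equiv.sumCongr φ.toEquiv (Equiv.refl Unit))).trans (Equiv.ofBijective _ normVec_bij)) ?_)
  intro t
  have h := quintic_rep _ (normVec_ne (Sum.map (Prod.map φ φ) (Sum.map φ id) t))
  have hm : ∀ i, normVec (Sum.map (Prod.map φ φ) (Sum.map φ id) t) i = φ (normVec t i) :=
    normVec_map (φ : NineModel →+* GaloisField 3 2) t
  have hq := quintic_map (φ : NineModel →+* GaloisField 3 2)
    (normVec t 0) (normVec t 1) (normVec t 2)
  simp only [RingEquiv.coe_toRingHom] at hq
  rw [hm, hm, hm, hq, map_eq_zero_iff _ φ.injective] at h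
  exact h
end
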